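/- arXiv:0707.0829 — 4 statements merged into one kernel-verified Lean document; each statement's English description precedes it below -/
import Mathlib

section
/- Let V : ℝⁿ → ℝ be continuously differentiable, E₀ ∈ ℝ, and suppose there exist ν₀ ∈ (0,2] and c₀ > 0 such that ν₀(E₀ − V(y)) − ⟨y, ∇V(y)⟩ ≥ c₀ for all y ∈ ℝⁿ. Let x, ξ : ℝ → ℝⁿ be differentiable with x'(t) = 2ξ(t) and ξ'(t) = −∇V(x(t)) for all t, and assume the energy constraint |ξ(t)|² + V(x(t)) = E₀ for all t. Then for every t, the derivative of t ↦ ⟨x(t), ξ(t)⟩ satisfies d/dt ⟨x(t), ξ(t)⟩ = 2|ξ(t)|² − ⟨x(t), ∇V(x(t))⟩ ≥ c₀. -/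
open RealInnerProductSpace

/-- Under Wang's generalized virial condition
`ν₀(E₀ − V(y)) − ⟨y, ∇V(y)⟩ ≥ c₀`, along any solution of the Hamiltonian system
`x' = 2ξ`, `ξ' = −∇V(x)` lying in the energy surface `|ξ|² + V(x) = E₀`,
the function `t ↦ ⟨x(t), ξ(t)⟩` has derivative
`2|ξ(t)|² − ⟨x(t), ∇V(x(t))⟩ ≥ c₀`. -/
theorem deriv_inner_pos_of_virial
    {n : ℕ} (V : EuclideanSpace ℝ (Fin n) → ℝ) (hV : ContDiff ℝ 1 V)
    (E₀ ν₀ c₀ : ℝ) (hν₀ : ν₀ ∈ Set.Ioc (0 : ℝ) 2) (hc₀ : 0 < c₀)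
    (hvirial : ∀ y : EuclideanSpace ℝ (Fin n), c₀ ≤ ν₀ * (E₀ - V y) - ⟪y, gradient V y⟫)
    (x ξ : ℝ → EuclideanSpace ℝ (Fin n))
    (hx : ∀ t : ℝ, HasDerivAt x ((2 : ℝ) • ξ t) t)
    (hξ : ∀ t : ℝ, HasDerivAt ξ (-(gradient V (x t))) t)
    (henergy : ∀ t : ℝ, ‖ξ t‖ ^ 2 + V (x t) = E₀) (t : ℝ) :
    HasDerivAt (fun s : ℝ => ⟪x s, ξ s⟫)
        (2 * ‖ξ t‖ ^ 2 - ⟪x t, gradient V (x t)⟫) t ∧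
      c₀ ≤ 2 * ‖ξ t‖ ^ 2 - ⟪x t, gradient V (x t)⟫ := by
  constructor
  · refine ((hx t).inner ℝ (hξ t)).congr_deriv ?_
    rw [inner_neg_right, real_inner_smul_left, real_inner_self_eq_norm_sq]
    ring
  · have h := hvirial (x t)
    have hE : E₀ - V (x t) = ‖ξ t‖ ^ 2 := by linarith [henergy t]
    rw [hE] at h
    have hle : ν₀ * ‖ξ t‖ ^ 2 ≤ 2 * ‖ξ t‖ ^ 2 :=
      mul_le_mul_of_nonneg_right hν₀.2 (sq_nonneg _)
    linarith
end

section
/- Let V : ℝⁿ → ℝ be continuously differentiable, E₀ ∈ ℝ, and suppose there exist ν₀ ∈ (0,2] and c₀ > 0 such that ν₀(E₀ − V(y)) − ⟨y, ∇V(y)⟩ ≥ c₀ for all y ∈ ℝⁿ. Let x, ξ : ℝ → ℝⁿ be differentiable with x'(t) = 2ξ(t) and ξ'(t) = −∇V(x(t)) for all t, with |ξ(t)|² + V(x(t)) = E₀ for all t, and with x(0) = 0. Then x(t) ≠ 0 for every t > 0 (the trajectory never returns to the origin). -/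
open RealInnerProductSpace

/-- Under Wang's generalized virial condition, a Hamiltonian trajectory
(for `p(x,ξ) = |ξ|² + V(x)`) in the energy surface `E₀` issued from the
spatial origin never returns to the origin at positive times. -/
theorem no_return_to_origin_of_virial
    {n : ℕ} (V : EuclideanSpace ℝ (Fin n) → ℝ) (hV : ContDiff ℝ 1 V)
    (E₀ ν₀ c₀ : ℝ) (hν₀ : ν₀ ∈ Set.Ioc (0 : ℝ) 2) (hc₀ : 0 < c₀)
    (hvirial : ∀ y : EuclideanSpace ℝ (Fin n), c₀ ≤ ν₀ * (E₀ - V y) - ⟪y, gradient V y⟫)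
    (x ξ : ℝ → EuclideanSpace ℝ (Fin n))
    (hx : ∀ t : ℝ, HasDerivAt x ((2 : ℝ) • ξ t) t)
    (hξ : ∀ t : ℝ, HasDerivAt ξ (-(gradient V (x t))) t)
    (henergy : ∀ t : ℝ, ‖ξ t‖ ^ 2 + V (x t) = E₀)
    (hx0 : x 0 = 0) :
    ∀ t : ℝ, 0 < t → x t ≠ 0 := by
  have hderiv : ∀ t : ℝ, HasDerivAt (fun s => ⟪x s, ξ s⟫)
      (⟪x t, -(gradient V (x t))⟫ + ⟪(2 : ℝ) • ξ t, ξ t⟫) t :=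
    fun t => (hx t).inner ℝ (hξ t)
  have hmono : StrictMono (fun s => ⟪x s, ξ s⟫) := by
    refine strictMono_of_deriv_pos fun t => ?_
    rw [(hderiv t).deriv, inner_neg_right, real_inner_smul_left, real_inner_self_eq_norm_sq]
    have hkin : E₀ - V (x t) = ‖ξ t‖ ^ 2 := by linarith [henergy t]
    have hvir := hvirial (x t)
    rw [hkin] at hvir
    have hle : ν₀ * ‖ξ t‖ ^ 2 ≤ 2 * ‖ξ t‖ ^ 2 :=
      mul_le_mul_of_nonneg_right hν₀.2 (sq_nonneg _)
    linarith
  intro t ht hxt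
  have hlt : ⟪x 0, ξ 0⟫ < ⟪x t, ξ t⟫ := hmono ht
  simp [hx0, hxt] at hlt
end

section
/- Let 1 ≤ m ≤ n, let U₁, U₂ ⊆ ℝᵐ be open sets, and for i = 1, 2 let fᵢ : Uᵢ → ℝⁿ be a continuously differentiable map which is a homeomorphism onto its image and whose derivative Dfᵢ(u) is injective at every u ∈ Uᵢ (a C¹ embedding). Let S ⊆ f₁(U₁) ∩ f₂(U₂). Then f₁⁻¹(S) has Lebesgue measure zero in ℝᵐ if and only if f₂⁻¹(S) has Lebesgue measure zero in ℝᵐ. -/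
open MeasureTheory

/-- A map which is strictly differentiable at `a` with a left invertible derivative admits a local
left inverse which is differentiable at `f a`. -/
theorem HasStrictFDerivAt.exists_differentiableAt_leftInverse
    {E F : Type*} [NormedAddCommGroup E] [NormedSpace ℝ E] [CompleteSpace E]
    [NormedAddCommGroup F] [NormedSpace ℝ F] {f : E → F} {f' : E →L[ℝ] F} {a : E}
    (hf : HasStrictFDerivAt f f' a) (hf' : f'.HasLeftInverse) :
    ∃ g : F → E, DifferentiableAt ℝ g (f a) ∧ ∀ᶠ x in nhds a, g (f x) = x := by
  obtain ⟨L, hL⟩ := hf'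
  have hLf : HasStrictFDerivAt (fun x => L (f x))
      (ContinuousLinearEquiv.refl ℝ E : E →L[ℝ] E) a := by
    convert L.hasStrictFDerivAt.comp a hf using 1
    ext x
    exact (hL x).symm
  exact ⟨fun y => hLf.localInverse _ _ _ (L y),
    hLf.to_localInverse.differentiableAt.comp (f a) L.differentiableAt,
    hLf.eventually_left_inverse⟩

/-- If `f` is a `C¹` embedding of an open set `U`, then a map `φ` with values in `U` is
differentiable as soon as `f ∘ φ` is. -/
theorem DifferentiableOn.of_comp_isEmbedding
    {D E F : Type*} [NormedAddCommGroup D] [NormedSpace ℝ D]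
    [NormedAddCommGroup E] [NormedSpace ℝ E] [FiniteDimensional ℝ E]
    [NormedAddCommGroup F] [NormedSpace ℝ F] [FiniteDimensional ℝ F]
    {f : E → F} {U : Set E} {φ : D → E} {A : Set D} (hU : IsOpen U) (hf : ContDiffOn ℝ 1 f U)
    (hemb : Topology.IsEmbedding fun u : U => f u)
    (hinj : ∀ u ∈ U, Function.Injective (fderiv ℝ f u))
    (hφ : Set.MapsTo φ A U) (hfφ : DifferentiableOn ℝ (f ∘ φ) A) :
    DifferentiableOn ℝ φ A := by
  have hcont : ContinuousOn φ A := by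
    have : Continuous (hφ.restrict φ A U) :=
      hemb.continuous_iff.2 (continuousOn_iff_continuous_domRestrict.1 hfφ.continuousOn)
    exact continuousOn_iff_continuous_domRestrict.2 (continuous_subtype_val.comp this)
  intro u hu
  obtain ⟨g, hg, hgf⟩ :=
    ((hf.contDiffAt (hU.mem_nhds (hφ hu))).hasStrictFDerivAt
      one_ne_zero).exists_differentiableAt_leftInverse
      (.of_injective_of_finiteDimensional (hinj _ (hφ hu)))
  exact (hg.comp_differentiableWithinAt u (hfφ u hu)).congr_of_eventuallyEq_of_mem
    (((hcont u hu).eventually hgf).mono fun _ h => h.symm) hu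

/-- Transporting a null set along the transition map from a differentiable map to a `C¹`
embedding yields a null set. -/
theorem null_preimage_of_isEmbedding
    {E F : Type*} [NormedAddCommGroup E] [NormedSpace ℝ E] [FiniteDimensional ℝ E]
    [MeasurableSpace E] [BorelSpace E] (μ : Measure E) [μ.IsAddHaarMeasure]
    [NormedAddCommGroup F] [NormedSpace ℝ F] [FiniteDimensional ℝ F]
    {f₁ f₂ : E → F} {U₁ U₂ : Set E} {S : Set F} (hU₂ : IsOpen U₂)
    (hf₁ : DifferentiableOn ℝ f₁ U₁) (hf₂ : ContDiffOn ℝ 1 f₂ U₂)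
    (hemb : Topology.IsEmbedding fun u : U₂ => f₂ u)
    (hinj : ∀ u ∈ U₂, Function.Injective (fderiv ℝ f₂ u))
    (hS : S ⊆ f₁ '' U₁ ∩ f₂ '' U₂) (h : μ (f₁ ⁻¹' S ∩ U₁) = 0) :
    μ (f₂ ⁻¹' S ∩ U₂) = 0 := by
  have hinv : ∀ u ∈ f₁ ⁻¹' S ∩ U₁, ∃ v ∈ U₂, f₂ v = f₁ u := fun u hu => (hS hu.1).2
  choose! φ hφU hφ using hinv
  have hdiff : DifferentiableOn ℝ φ (f₁ ⁻¹' S ∩ U₁) :=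
    .of_comp_isEmbedding hU₂ hf₂ hemb hinj hφU ((hf₁.mono Set.inter_subset_right).congr hφ)
  refine measure_mono_null ?_
    (addHaar_image_eq_zero_of_differentiableOn_of_addHaar_eq_zero μ hdiff h)
  rintro v ⟨hvS, hvU⟩
  obtain ⟨u, huU, huv⟩ := (hS hvS).1
  have hu : u ∈ f₁ ⁻¹' S ∩ U₁ := ⟨by rwa [Set.mem_preimage, huv], huU⟩
  exact ⟨u, hu, Set.injOn_iff_injective.2 hemb.injective (hφU u hu) hvU ((hφ u hu).trans huv)⟩

/-- For two C¹ embeddings `f₁ : U₁ → ℝⁿ`, `f₂ : U₂ → ℝⁿ` of open sets of `ℝᵐ`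
(`1 ≤ m ≤ n`) with everywhere injective derivative, and a set
`S ⊆ f₁(U₁) ∩ f₂(U₂)`, the preimage `f₁⁻¹(S)` is Lebesgue-null in `ℝᵐ` if and
only if `f₂⁻¹(S)` is. -/
theorem null_preimage_iff_of_two_embeddings
    {m n : ℕ} (hm : 1 ≤ m) (hmn : m ≤ n)
    (U₁ U₂ : Set (EuclideanSpace ℝ (Fin m))) (hU₁ : IsOpen U₁) (hU₂ : IsOpen U₂)
    (f₁ f₂ : EuclideanSpace ℝ (Fin m) → EuclideanSpace ℝ (Fin n))
    (hf₁ : ContDiffOn ℝ 1 f₁ U₁) (hf₂ : ContDiffOn ℝ 1 f₂ U₂)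
    (hemb₁ : Topology.IsEmbedding fun u : U₁ => f₁ u)
    (hemb₂ : Topology.IsEmbedding fun u : U₂ => f₂ u)
    (hD₁ : ∀ u ∈ U₁, Function.Injective (fderiv ℝ f₁ u))
    (hD₂ : ∀ u ∈ U₂, Function.Injective (fderiv ℝ f₂ u))
    (S : Set (EuclideanSpace ℝ (Fin n))) (hS : S ⊆ f₁ '' U₁ ∩ f₂ '' U₂) :
    volume (f₁ ⁻¹' S ∩ U₁) = 0 ↔ volume (f₂ ⁻¹' S ∩ U₂) = 0 := by
  exact ⟨null_preimage_of_isEmbedding volume hU₂ (hf₁.differentiableOn one_ne_zero) hf₂ hemb₂ hD₂ hS,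
    null_preimage_of_isEmbedding volume hU₁ (hf₂.differentiableOn one_ne_zero) hf₁ hemb₁ hD₁
      (Set.inter_comm _ _ ▸ hS)⟩
end

section
/- Let n ≥ 1. Let q : ℝⁿ × ℝⁿ → ℂ be smooth with compact support, let g : ℝⁿ → ℂ be smooth with compact support and equal to 1 on a neighborhood of 0, and let S : ℝⁿ → ℂ be a Schwartz function with Fourier transform Ŝ(ξ) = (2π)^{−n/2} ∫_{ℝⁿ} e^{−i x·ξ} S(x) dx. Then lim_{h→0⁺} (2π)^{−2n} h^{−n} ∭_{ℝⁿ×ℝⁿ×ℝⁿ} q(x,ξ) g(x) e^{i x·(ξ−θ)/h} Ŝ(ξ) \overline{Ŝ(θ)} dθ dξ dx = (2π)^{−n} ∫_{ℝⁿ} q(0,ξ) |Ŝ(ξ)|² dξ. -/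
open MeasureTheory RealInnerProductSpace Filter

/-- The Fourier transform `Ŝ(ξ) = (2π)^{−n/2} ∫ e^{−i x·ξ} S(x) dx` on `ℝⁿ`. -/
noncomputable def fourierEuclidean {n : ℕ} (S : EuclideanSpace ℝ (Fin n) → ℂ)
    (ξ : EuclideanSpace ℝ (Fin n)) : ℂ :=
  ((2 * Real.pi) ^ (-(n : ℝ) / 2) : ℝ) •
    ∫ x : EuclideanSpace ℝ (Fin n), Complex.exp (-Complex.I * ((⟪x, ξ⟫ : ℝ) : ℂ)) * S x

section Auxiliary

variable {n : ℕ}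

open scoped FourierTransform SchwartzMap

theorem fourierEuclidean_eq_fourier (S : 𝓢(EuclideanSpace ℝ (Fin n), ℂ))
    (ξ : EuclideanSpace ℝ (Fin n)) :
    fourierEuclidean (fun y => S y) ξ =
      (((2 * Real.pi) ^ (-(n : ℝ) / 2) : ℝ) : ℂ) * (𝓕 S) ((2 * Real.pi)⁻¹ • ξ) := by
  rw [fourierEuclidean, SchwartzMap.fourier_coe, Real.fourier_eq', Complex.real_smul]
  congr 2 with x
  rw [smul_eq_mul, inner_smul_right]
  congr 2
  push_cast
  have : (Real.pi : ℂ) ≠ 0 := by exact_mod_cast Real.pi_ne_zero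
  field_simp

theorem continuous_fourierEuclidean (S : 𝓢(EuclideanSpace ℝ (Fin n), ℂ)) :
    Continuous (fourierEuclidean fun y => S y) := by
  rw [funext (fourierEuclidean_eq_fourier S)]
  exact continuous_const.mul ((𝓕 S).continuous.comp (continuous_const_smul _))

theorem integrable_fourierEuclidean (S : 𝓢(EuclideanSpace ℝ (Fin n), ℂ)) :
    Integrable (fourierEuclidean fun y => S y) := by
  rw [funext (fourierEuclidean_eq_fourier S)]
  exact ((𝓕 S).integrable.comp_smul (by positivity)).const_mul _

theorem two_pi_rpow_neg_half_mul_pow (n : ℕ) :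
    (2 * Real.pi) ^ (-(n : ℝ) / 2) * (2 * Real.pi) ^ n = (2 * Real.pi) ^ ((n : ℝ) / 2) := by
  rw [← Real.rpow_natCast, ← Real.rpow_add (by positivity)]
  ring_nf

theorem two_pi_pow_eq_rpow_half_mul (n : ℕ) :
    (2 * Real.pi) ^ ((n : ℝ) / 2) * (2 * Real.pi) ^ ((n : ℝ) / 2) = (2 * Real.pi) ^ n := by
  rw [← Real.rpow_natCast, ← Real.rpow_add (by positivity)]
  ring_nf

/-- Fourier inversion for `fourierEuclidean`. -/
theorem integral_exp_mul_fourierEuclidean (S : 𝓢(EuclideanSpace ℝ (Fin n), ℂ))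
    (y : EuclideanSpace ℝ (Fin n)) :
    ∫ θ, Complex.exp (Complex.I * ((⟪y, θ⟫ : ℝ) : ℂ)) * fourierEuclidean (fun y => S y) θ =
      (((2 * Real.pi) ^ ((n : ℝ) / 2) : ℝ) : ℂ) * S y := by
  have hinv : 𝓕⁻ (𝓕 S) y = S y := by simp
  rw [SchwartzMap.fourierInv_coe, Real.fourierInv_eq'] at hinv
  have hscale := Measure.integral_comp_inv_smul (volume : Measure (EuclideanSpace ℝ (Fin n)))
    (fun v => Complex.exp (((2 * Real.pi * ⟪v, y⟫ : ℝ) : ℂ) * Complex.I) • (𝓕 S) v)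
    (2 * Real.pi)
  rw [hinv, finrank_euclideanSpace_fin, abs_of_pos (by positivity)] at hscale
  rw [← two_pi_rpow_neg_half_mul_pow, Complex.ofReal_mul, mul_assoc, ← Complex.real_smul (z := S y),
    ← hscale, ← integral_const_mul]
  congr 1 with θ
  rw [fourierEuclidean_eq_fourier, inner_smul_left, smul_eq_mul, real_inner_comm]
  have : (2 * Real.pi * ((starRingEnd ℝ) (2 * Real.pi)⁻¹ * ⟪θ, y⟫)) = ⟪θ, y⟫ := by
    simp only [conj_trivial]
    field_simp
  rw [this, mul_comm Complex.I]
  ring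

theorem integral_exp_neg_mul_conj_fourierEuclidean (S : 𝓢(EuclideanSpace ℝ (Fin n), ℂ))
    (y : EuclideanSpace ℝ (Fin n)) :
    ∫ θ, Complex.exp (-Complex.I * ((⟪y, θ⟫ : ℝ) : ℂ)) *
        (starRingEnd ℂ) (fourierEuclidean (fun y => S y) θ) =
      (((2 * Real.pi) ^ ((n : ℝ) / 2) : ℝ) : ℂ) * (starRingEnd ℂ) (S y) := by
  have h := congrArg (starRingEnd ℂ) (integral_exp_mul_fourierEuclidean S y)
  rw [← integral_conj] at h
  simpa only [map_mul, ← Complex.exp_conj, Complex.conj_I, Complex.conj_ofReal] using h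

theorem integral_exp_mul_conj (S : 𝓢(EuclideanSpace ℝ (Fin n), ℂ))
    (ξ : EuclideanSpace ℝ (Fin n)) :
    ∫ y, Complex.exp (Complex.I * ((⟪y, ξ⟫ : ℝ) : ℂ)) * (starRingEnd ℂ) (S y) =
      (((2 * Real.pi) ^ ((n : ℝ) / 2) : ℝ) : ℂ) *
        (starRingEnd ℂ) (fourierEuclidean (fun y => S y) ξ) := by
  have hc : (2 * Real.pi) ^ ((n : ℝ) / 2) * (2 * Real.pi) ^ (-(n : ℝ) / 2) = 1 := by
    rw [← Real.rpow_add (by positivity)]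
    ring_nf
    simp
  rw [fourierEuclidean, Complex.real_smul, map_mul, Complex.conj_ofReal, ← mul_assoc,
    ← Complex.ofReal_mul, hc, Complex.ofReal_one, one_mul, ← integral_conj]
  simp only [map_mul, ← Complex.exp_conj, map_neg, Complex.conj_I, Complex.conj_ofReal, neg_neg]

/-- The integrand left after integrating in `θ` and rescaling `x = h y`. -/
noncomputable def rescaledIntegrand
    (a : EuclideanSpace ℝ (Fin n) × EuclideanSpace ℝ (Fin n) → ℂ)
    (S : 𝓢(EuclideanSpace ℝ (Fin n), ℂ)) (h : ℝ)
    (p : EuclideanSpace ℝ (Fin n) × EuclideanSpace ℝ (Fin n)) : ℂ :=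
  a (h • p.1, p.2) * Complex.exp (Complex.I * ((⟪p.1, p.2⟫ : ℝ) : ℂ)) *
    (fourierEuclidean (fun y => S y) p.2 * (starRingEnd ℂ) (S p.1))

variable {a : EuclideanSpace ℝ (Fin n) × EuclideanSpace ℝ (Fin n) → ℂ}

theorem continuous_rescaledIntegrand (ha : Continuous a)
    (S : 𝓢(EuclideanSpace ℝ (Fin n), ℂ)) :
    Continuous fun z : ℝ × (EuclideanSpace ℝ (Fin n) × EuclideanSpace ℝ (Fin n)) =>
      rescaledIntegrand a S z.1 z.2 := by
  have h1 := continuous_fourierEuclidean S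
  have h2 := S.continuous
  unfold rescaledIntegrand
  fun_prop

theorem norm_rescaledIntegrand_le {C : ℝ} (hC : ∀ p, ‖a p‖ ≤ C)
    (S : 𝓢(EuclideanSpace ℝ (Fin n), ℂ)) (h : ℝ)
    (p : EuclideanSpace ℝ (Fin n) × EuclideanSpace ℝ (Fin n)) :
    ‖rescaledIntegrand a S h p‖ ≤
      C * (‖S p.1‖ * ‖fourierEuclidean (fun y => S y) p.2‖) := by
  have he : ‖Complex.exp (Complex.I * ((⟪p.1, p.2⟫ : ℝ) : ℂ))‖ = 1 := by
    rw [mul_comm]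
    exact Complex.norm_exp_ofReal_mul_I _
  rw [rescaledIntegrand, norm_mul, norm_mul, norm_mul, he, mul_one, RCLike.norm_conj,
    mul_comm ‖S p.1‖]
  gcongr
  exact hC _

theorem integrable_norm_mul_norm_fourierEuclidean (C : ℝ)
    (S : 𝓢(EuclideanSpace ℝ (Fin n), ℂ)) :
    Integrable fun p : EuclideanSpace ℝ (Fin n) × EuclideanSpace ℝ (Fin n) =>
      C * (‖S p.1‖ * ‖fourierEuclidean (fun y => S y) p.2‖) :=
  (S.integrable.norm.mul_prod (integrable_fourierEuclidean S).norm).const_mul C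

theorem integrable_rescaledIntegrand (ha : Continuous a) {C : ℝ} (hC : ∀ p, ‖a p‖ ≤ C)
    (S : 𝓢(EuclideanSpace ℝ (Fin n), ℂ)) (h : ℝ) :
    Integrable (rescaledIntegrand a S h) :=
  (integrable_norm_mul_norm_fourierEuclidean C S).mono'
    ((continuous_rescaledIntegrand ha S).comp (Continuous.prodMk_right h)).aestronglyMeasurable
    (.of_forall (norm_rescaledIntegrand_le hC S h))

theorem tendsto_integral_rescaledIntegrand (ha : Continuous a) {C : ℝ} (hC : ∀ p, ‖a p‖ ≤ C)
    (S : 𝓢(EuclideanSpace ℝ (Fin n), ℂ)) :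
    Tendsto (fun h => ∫ p, rescaledIntegrand a S h p) (nhds 0)
      (nhds (∫ p, rescaledIntegrand a S 0 p)) :=
  tendsto_integral_filter_of_dominated_convergence _
    (.of_forall fun h => (integrable_rescaledIntegrand ha hC S h).aestronglyMeasurable)
    (.of_forall fun h => .of_forall (norm_rescaledIntegrand_le hC S h))
    (integrable_norm_mul_norm_fourierEuclidean C S)
    (.of_forall fun p =>
      ((continuous_rescaledIntegrand ha S).comp (Continuous.prodMk_left p)).tendsto 0)

theorem integral_rescaledIntegrand_zero (ha : Continuous a) {C : ℝ} (hC : ∀ p, ‖a p‖ ≤ C)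
    (S : 𝓢(EuclideanSpace ℝ (Fin n), ℂ)) :
    ∫ p, rescaledIntegrand a S 0 p =
      (((2 * Real.pi) ^ ((n : ℝ) / 2) : ℝ) : ℂ) *
        ∫ ξ, a (0, ξ) * ((‖fourierEuclidean (fun y => S y) ξ‖ ^ 2 : ℝ) : ℂ) := by
  have hint := integrable_rescaledIntegrand ha hC S 0
  rw [Measure.volume_eq_prod] at hint ⊢
  rw [integral_prod_symm _ hint, ← integral_const_mul]
  congr 1 with ξ
  have hξ : ∀ y, rescaledIntegrand a S 0 (y, ξ) =
      a (0, ξ) * fourierEuclidean (fun y => S y) ξ *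
        (Complex.exp (Complex.I * ((⟪y, ξ⟫ : ℝ) : ℂ)) * (starRingEnd ℂ) (S y)) := by
    intro y
    simp only [rescaledIntegrand, zero_smul]
    ring
  simp_rw [hξ]
  rw [integral_const_mul, integral_exp_mul_conj, Complex.ofReal_pow, ← Complex.mul_conj']
  ring

theorem integral_oscillatory_eq_integral_rescaledIntegrand (ha : Continuous a) {C : ℝ}
    (hC : ∀ p, ‖a p‖ ≤ C) (S : 𝓢(EuclideanSpace ℝ (Fin n), ℂ)) {h : ℝ} (hh : 0 < h) :
    ∫ x, ∫ ξ, ∫ θ, a (x, ξ) * Complex.exp (Complex.I * ((⟪x, ξ - θ⟫ : ℝ) : ℂ) / (h : ℂ)) *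
        fourierEuclidean (fun y => S y) ξ *
        (starRingEnd ℂ) (fourierEuclidean (fun y => S y) θ) =
      ((h ^ n : ℝ) : ℂ) * ((((2 * Real.pi) ^ ((n : ℝ) / 2) : ℝ) : ℂ) *
        ∫ p, rescaledIntegrand a S h p) := by
  have hθ : ∀ x ξ, ∫ θ, a (x, ξ) *
        Complex.exp (Complex.I * ((⟪x, ξ - θ⟫ : ℝ) : ℂ) / (h : ℂ)) *
        fourierEuclidean (fun y => S y) ξ *
        (starRingEnd ℂ) (fourierEuclidean (fun y => S y) θ) =
      (((2 * Real.pi) ^ ((n : ℝ) / 2) : ℝ) : ℂ) * rescaledIntegrand a S h (h⁻¹ • x, ξ) := by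
    intro x ξ
    have hexp : ∀ θ, Complex.exp (Complex.I * ((⟪x, ξ - θ⟫ : ℝ) : ℂ) / (h : ℂ)) =
        Complex.exp (Complex.I * ((⟪h⁻¹ • x, ξ⟫ : ℝ) : ℂ)) *
          Complex.exp (-Complex.I * ((⟪h⁻¹ • x, θ⟫ : ℝ) : ℂ)) := by
      intro θ
      rw [← Complex.exp_add, inner_sub_right, real_inner_smul_left, real_inner_smul_left]
      push_cast
      ring_nf
    have hsplit : ∀ θ, a (x, ξ) *
          Complex.exp (Complex.I * ((⟪x, ξ - θ⟫ : ℝ) : ℂ) / (h : ℂ)) *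
          fourierEuclidean (fun y => S y) ξ *
          (starRingEnd ℂ) (fourierEuclidean (fun y => S y) θ) =
        a (x, ξ) * Complex.exp (Complex.I * ((⟪h⁻¹ • x, ξ⟫ : ℝ) : ℂ)) *
          fourierEuclidean (fun y => S y) ξ *
          (Complex.exp (-Complex.I * ((⟪h⁻¹ • x, θ⟫ : ℝ) : ℂ)) *
            (starRingEnd ℂ) (fourierEuclidean (fun y => S y) θ)) := by
      intro θ
      rw [hexp]
      ring
    simp_rw [hsplit]
    rw [integral_const_mul, integral_exp_neg_mul_conj_fourierEuclidean, rescaledIntegrand,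
      smul_inv_smul₀ hh.ne']
    ring
  simp_rw [hθ, integral_const_mul]
  rw [Measure.integral_comp_inv_smul volume (fun y => ∫ ξ, rescaledIntegrand a S h (y, ξ)) h,
    finrank_euclideanSpace_fin, abs_of_pos (by positivity), Complex.real_smul,
    Measure.volume_eq_prod, integral_prod _ (integrable_rescaledIntegrand ha hC S h)]
  ring

end Auxiliary

/-- Semiclassical limit of the oscillatory integral computing
`⟨Op(q) S_h, S_h⟩` by stationary phase in `(x,θ)`:
`(2π)^{−2n} h^{−n} ∭ q(x,ξ) g(x) e^{i x·(ξ−θ)/h} Ŝ(ξ) conj(Ŝ(θ)) dθ dξ dx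
  → (2π)^{−n} ∫ q(0,ξ) |Ŝ(ξ)|² dξ` as `h → 0⁺`. -/
theorem oscillatory_integral_limit_source
    {n : ℕ} (hn : 1 ≤ n)
    (q : EuclideanSpace ℝ (Fin n) × EuclideanSpace ℝ (Fin n) → ℂ)
    (hq : ContDiff ℝ (⊤ : ℕ∞) q) (hqsupp : HasCompactSupport q)
    (g : EuclideanSpace ℝ (Fin n) → ℂ)
    (hg : ContDiff ℝ (⊤ : ℕ∞) g) (hgsupp : HasCompactSupport g)
    (hg1 : ∀ᶠ x in nhds (0 : EuclideanSpace ℝ (Fin n)), g x = 1)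
    (S : SchwartzMap (EuclideanSpace ℝ (Fin n)) ℂ) :
    Tendsto (fun h : ℝ =>
        (((((2 * Real.pi) ^ (2 * n))⁻¹ : ℝ) : ℂ) * (((h ^ n)⁻¹ : ℝ) : ℂ)) *
          ∫ x : EuclideanSpace ℝ (Fin n), ∫ ξ : EuclideanSpace ℝ (Fin n),
            ∫ θ : EuclideanSpace ℝ (Fin n),
              q (x, ξ) * g x * Complex.exp (Complex.I * ((⟪x, ξ - θ⟫ : ℝ) : ℂ) / (h : ℂ)) *
                fourierEuclidean (fun y => S y) ξ *
                (starRingEnd ℂ) (fourierEuclidean (fun y => S y) θ))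
      (nhdsWithin 0 (Set.Ioi 0))
      (nhds (((((2 * Real.pi) ^ n)⁻¹ : ℝ) : ℂ) *
        ∫ ξ : EuclideanSpace ℝ (Fin n),
          q (0, ξ) * ((‖fourierEuclidean (fun y => S y) ξ‖ ^ 2 : ℝ) : ℂ))) := by
  have ha : Continuous fun p : EuclideanSpace ℝ (Fin n) × EuclideanSpace ℝ (Fin n) =>
      q p * g p.1 := hq.continuous.mul (hg.continuous.comp continuous_fst)
  obtain ⟨C, hC⟩ := (hqsupp.mul_right (f' := fun p => g p.1)).exists_bound_of_continuous ha
  have hlim := ((tendsto_integral_rescaledIntegrand ha hC S).mono_left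
    (nhdsWithin_le_nhds (s := Set.Ioi 0))).const_mul
      (((((2 * Real.pi) ^ (2 * n))⁻¹ : ℝ) : ℂ) * (((2 * Real.pi) ^ ((n : ℝ) / 2) : ℝ) : ℂ))
  rw [integral_rescaledIntegrand_zero ha hC S] at hlim
  have hc : ((((2 * Real.pi) ^ (2 * n))⁻¹ : ℝ) : ℂ) *
      ((((2 * Real.pi) ^ ((n : ℝ) / 2) : ℝ) : ℂ) * (((2 * Real.pi) ^ ((n : ℝ) / 2) : ℝ) : ℂ)) =
      ((((2 * Real.pi) ^ n)⁻¹ : ℝ) : ℂ) := by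
    rw [← Complex.ofReal_mul, ← Complex.ofReal_mul, two_pi_pow_eq_rpow_half_mul, two_mul n, pow_add]
    congr 1
    field_simp
  have hg0 : g 0 = 1 := hg1.self_of_nhds
  rw [← mul_assoc, mul_assoc (Complex.ofReal _), hc] at hlim
  simp only [hg0, mul_one] at hlim
  refine hlim.congr' ?_
  filter_upwards [self_mem_nhdsWithin] with h hh
  have hh : 0 < h := hh
  rw [integral_oscillatory_eq_integral_rescaledIntegrand
    (a := fun p => q p * g p.1) ha hC S hh]
  have hpow : (((h ^ n)⁻¹ : ℝ) : ℂ) * ((h ^ n : ℝ) : ℂ) = 1 := by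
    rw [← Complex.ofReal_mul, inv_mul_cancel₀ (by positivity), Complex.ofReal_one]
  linear_combination (-((((2 * Real.pi) ^ (2 * n))⁻¹ : ℝ) : ℂ) *
    (((2 * Real.pi) ^ ((n : ℝ) / 2) : ℝ) : ℂ) *
    ∫ p, rescaledIntegrand (fun p => q p * g p.1) S h p) * hpow
end
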